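/- arXiv:1409.5984 — 3 statements merged into one kernel-verified Lean document; each statement's English description precedes it below -/
import Mathlib

section
/- Let M ≥ 1 be an integer, let Υ_ν, Υ_e, Υ_u, Υ_d be M×M complex matrices, let a_u := tr(Υ_ν†Υ_ν) + 3·tr(Υ_u†Υ_u) and a_d := tr(Υ_e†Υ_e) + 3·tr(Υ_d†Υ_d), and assume a_u > 0 and a_d > 0. Let ω_11, ω_12 be real numbers satisfying (M/2)·ω_11·a_u = ω_12·tr(Υ_ν†Υ_ν), (M/2)·ω_11·a_d = ω_12·tr(Υ_e†Υ_e), and 1_M = (1/a_u)·Υ_νᵗ(Υ_ν*)ᵗ + (1/a_d)·Υ_eᵗ(Υ_e*)ᵗ, where 1_M is the M×M identity matrix. Then ω_11 = ω_12. -/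
open Matrix

/-- Squared Frobenius norm. -/
noncomputable def frobSq {M : ℕ} (A : Matrix (Fin M) (Fin M) ℂ) : ℝ :=
  ∑ i, ∑ j, Complex.normSq (A i j)

lemma trace_eq_frobSq {M : ℕ} (A : Matrix (Fin M) (Fin M) ℂ) :
    (Aᴴ * A).trace = (frobSq A : ℂ) := by
  unfold frobSq
  rw [Finset.sum_comm]
  simp only [Matrix.trace, Matrix.diag, Matrix.mul_apply, Matrix.conjTranspose_apply]
  push_cast
  refine Finset.sum_congr rfl fun i _ => Finset.sum_congr rfl fun j _ => ?_
  exact (Complex.normSq_eq_conj_mul_self).symm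

lemma frobSq_nonneg {M : ℕ} (A : Matrix (Fin M) (Fin M) ℂ) : 0 ≤ frobSq A :=
  Finset.sum_nonneg fun _ _ => Finset.sum_nonneg fun _ _ => Complex.normSq_nonneg _

lemma re_trace_le {M : ℕ} (A : Matrix (Fin M) (Fin M) ℂ) :
    ((Aᵀ * (A.map (starRingEnd ℂ))ᵀ).trace).re ≤ frobSq A := by
  have h : frobSq A = ∑ i, ∑ j, (Complex.normSq (A i j) + Complex.normSq (A j i)) / 2 := by
    have h2 : frobSq A = ∑ i, ∑ j, Complex.normSq (A j i) := by
      unfold frobSq; rw [Finset.sum_comm]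
    simp only [← Finset.sum_div, Finset.sum_add_distrib]
    rw [← h2]
    change _ = (frobSq A + frobSq A) / 2
    ring
  rw [h]
  simp only [Matrix.trace, Matrix.diag, Matrix.mul_apply, Matrix.transpose_apply,
    Matrix.map_apply, Complex.re_sum]
  refine Finset.sum_le_sum fun i _ => Finset.sum_le_sum fun j _ => ?_
  simp only [Complex.mul_re, Complex.conj_re, Complex.conj_im, Complex.normSq_apply]
  nlinarith [sq_nonneg ((A i j).re - (A j i).re), sq_nonneg ((A i j).im - (A j i).im)]

lemma re_trace_one (A : Matrix (Fin 1) (Fin 1) ℂ) :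
    ((Aᵀ * (A.map (starRingEnd ℂ))ᵀ).trace).re = frobSq A := by
  simp [frobSq, Matrix.trace, Matrix.mul_apply, Complex.normSq_apply]

/-- For `M×M` complex Yukawa matrices `Υν`, `Υe`, `Υu`, `Υd` with
`a_u = tr(Υν† Υν) + 3 tr(Υu† Υu) > 0` and `a_d = tr(Υe† Υe) + 3 tr(Υd† Υd) > 0`,
if real coefficients `ω₁₁`, `ω₁₂` satisfy
`(M/2) ω₁₁ a_u = ω₁₂ tr(Υν† Υν)`, `(M/2) ω₁₁ a_d = ω₁₂ tr(Υe† Υe)` and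
`1 = (1/a_u) Υνᵗ (Υν*)ᵗ + (1/a_d) Υeᵗ (Υe*)ᵗ`, then `ω₁₁ = ω₁₂`. -/
theorem stmt_8 (M : ℕ) (hM : 1 ≤ M)
    (Υν Υe Υu Υd : Matrix (Fin M) (Fin M) ℂ)
    (a_u a_d : ℝ)
    (ha_u : (a_u : ℂ) = (Υνᴴ * Υν).trace + 3 * (Υuᴴ * Υu).trace)
    (ha_d : (a_d : ℂ) = (Υeᴴ * Υe).trace + 3 * (Υdᴴ * Υd).trace)
    (ha_u_pos : 0 < a_u) (ha_d_pos : 0 < a_d)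
    (ω11 ω12 : ℝ)
    (h1 : ((M : ℂ) / 2) * (ω11 : ℂ) * (a_u : ℂ) = (ω12 : ℂ) * (Υνᴴ * Υν).trace)
    (h2 : ((M : ℂ) / 2) * (ω11 : ℂ) * (a_d : ℂ) = (ω12 : ℂ) * (Υeᴴ * Υe).trace)
    (h3 : (1 : Matrix (Fin M) (Fin M) ℂ) =
      (1 / (a_u : ℂ)) • (Υνᵀ * (Υν.map (starRingEnd ℂ))ᵀ) +
      (1 / (a_d : ℂ)) • (Υeᵀ * (Υe.map (starRingEnd ℂ))ᵀ)) :
    ω11 = ω12 := by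
  rw [trace_eq_frobSq] at h1 h2
  rw [trace_eq_frobSq, trace_eq_frobSq] at ha_u ha_d
  have ha_u' : a_u = frobSq Υν + 3 * frobSq Υu := by exact_mod_cast ha_u
  have ha_d' : a_d = frobSq Υe + 3 * frobSq Υd := by exact_mod_cast ha_d
  have h1' : (M : ℝ) / 2 * ω11 * a_u = ω12 * frobSq Υν := by
    apply Complex.ofReal_injective; push_cast; exact h1
  have h2' : (M : ℝ) / 2 * ω11 * a_d = ω12 * frobSq Υe := by
    apply Complex.ofReal_injective; push_cast; exact h2
  have h4 : (M : ℝ) = (1 / a_u) * ((Υνᵀ * (Υν.map (starRingEnd ℂ))ᵀ).trace).re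
      + (1 / a_d) * ((Υeᵀ * (Υe.map (starRingEnd ℂ))ᵀ).trace).re := by
    have := congrArg (fun X => (Matrix.trace X).re) h3
    simp only [Matrix.trace_one, Matrix.trace_add, Matrix.trace_smul, Fintype.card_fin,
      smul_eq_mul, Complex.add_re, Complex.natCast_re] at this
    rw [this, ← Complex.re_ofReal_mul, ← Complex.re_ofReal_mul]
    push_cast
    rfl
  have hMr : (1 : ℝ) ≤ M := by exact_mod_cast hM
  by_cases hω : ω12 = 0
  · subst hω
    have : (M : ℝ) / 2 * a_u ≠ 0 := by positivity
    have h5 : ((M : ℝ) / 2 * a_u) * ω11 = 0 := by linarith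
    exact (mul_eq_zero.mp h5).resolve_left this
  obtain ⟨t, ht⟩ : ∃ t, t = (M : ℝ) / 2 * ω11 / ω12 := ⟨_, rfl⟩
  have hν : frobSq Υν = t * a_u := by rw [ht]; field_simp; linarith
  have he : frobSq Υe = t * a_d := by rw [ht]; field_simp; linarith
  have ht1 : t ≤ 1 := by
    have := frobSq_nonneg Υu
    by_contra hc
    push Not at hc
    nlinarith
  have hMt : (M : ℝ) ≤ 2 * t := by
    have e1 := mul_le_mul_of_nonneg_left (re_trace_le Υν) (by positivity : 0 ≤ 1 / a_u)
    have e2 := mul_le_mul_of_nonneg_left (re_trace_le Υe) (by positivity : 0 ≤ 1 / a_d)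
    rw [hν] at e1
    rw [he] at e2
    have f1 : 1 / a_u * (t * a_u) = t := by field_simp
    have f2 : 1 / a_d * (t * a_d) = t := by field_simp
    linarith
  have hM2 : M ≤ 2 := by
    have : (M : ℝ) ≤ 2 := by linarith
    exact_mod_cast this
  have key : (M : ℝ) = 2 * t := by
    obtain rfl | rfl : M = 1 ∨ M = 2 := by omega
    · rw [re_trace_one, re_trace_one, hν, he] at h4
      rw [h4]; field_simp; ring
    · push_cast at hMt ⊢
      linarith
  rw [key] at ht
  have ht0 : t ≠ 0 := by
    intro h; rw [h] at key; linarith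
  field_simp at ht
  linarith
end

section
/- Let M ≥ 1 be an integer, let Υ_ν, Υ_e, Υ_u, Υ_d be M×M complex matrices, let a_u := tr(Υ_ν†Υ_ν) + 3·tr(Υ_u†Υ_u) and a_d := tr(Υ_e†Υ_e) + 3·tr(Υ_d†Υ_d), and assume a_u > 0 and a_d > 0. Let ω_12 ≠ 0, ω_13, ω_23 be real numbers satisfying (M/2)·ω_13·a_u = ω_12·tr(Υ_u†Υ_u), (M/2)·ω_13·a_d = ω_12·tr(Υ_d†Υ_d), and (ω_23/ω_12)·1_M = (1/a_u)·Υ_u†Υ_u + (1/a_d)·Υ_d†Υ_d, where 1_M is the M×M identity matrix. Then ω_13 = ω_23. -/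
open Matrix

/-- For `M×M` complex Yukawa matrices `Υν`, `Υe`, `Υu`, `Υd` with
`a_u = tr(Υν† Υν) + 3 tr(Υu† Υu) > 0` and `a_d = tr(Υe† Υe) + 3 tr(Υd† Υd) > 0`,
if real coefficients `ω₁₂ ≠ 0`, `ω₁₃`, `ω₂₃` satisfy
`(M/2) ω₁₃ a_u = ω₁₂ tr(Υu† Υu)`, `(M/2) ω₁₃ a_d = ω₁₂ tr(Υd† Υd)` and
`(ω₂₃/ω₁₂) 1 = (1/a_u) Υu† Υu + (1/a_d) Υd† Υd`, then `ω₁₃ = ω₂₃`. -/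
theorem stmt_9 (M : ℕ) (hM : 1 ≤ M)
    (Υν Υe Υu Υd : Matrix (Fin M) (Fin M) ℂ)
    (a_u a_d : ℝ)
    (ha_u : (a_u : ℂ) = (Υνᴴ * Υν).trace + 3 * (Υuᴴ * Υu).trace)
    (ha_d : (a_d : ℂ) = (Υeᴴ * Υe).trace + 3 * (Υdᴴ * Υd).trace)
    (ha_u_pos : 0 < a_u) (ha_d_pos : 0 < a_d)
    (ω12 ω13 ω23 : ℝ) (hω12 : ω12 ≠ 0)
    (h1 : ((M : ℂ) / 2) * (ω13 : ℂ) * (a_u : ℂ) = (ω12 : ℂ) * (Υuᴴ * Υu).trace)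
    (h2 : ((M : ℂ) / 2) * (ω13 : ℂ) * (a_d : ℂ) = (ω12 : ℂ) * (Υdᴴ * Υd).trace)
    (h3 : ((ω23 / ω12 : ℝ) : ℂ) • (1 : Matrix (Fin M) (Fin M) ℂ) =
      (1 / (a_u : ℂ)) • (Υuᴴ * Υu) + (1 / (a_d : ℂ)) • (Υdᴴ * Υd)) :
    ω13 = ω23 := by
  have h := congrArg Matrix.trace h3
  simp only [Matrix.trace_add, Matrix.trace_smul, Matrix.trace_one, Fintype.card_fin,
    smul_eq_mul, Complex.ofReal_div] at h
  generalize (Υuᴴ * Υu).trace = tu at *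
  generalize (Υdᴴ * Υd).trace = td at *
  have hu : (a_u : ℂ) ≠ 0 := by exact_mod_cast ha_u_pos.ne'
  have hd : (a_d : ℂ) ≠ 0 := by exact_mod_cast ha_d_pos.ne'
  have hw : (ω12 : ℂ) ≠ 0 := by exact_mod_cast hω12
  have hM' : (M : ℂ) ≠ 0 := by
    have : M ≠ 0 := by omega
    exact_mod_cast this
  have e1 : tu = (M : ℂ) / 2 * ω13 * a_u / ω12 := by
    rw [eq_div_iff hw, h1]; ring
  have e2 : td = (M : ℂ) / 2 * ω13 * a_d / ω12 := by
    rw [eq_div_iff hw, h2]; ring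
  have key : (M : ℂ) / ω12 * (ω13 : ℂ) = (M : ℂ) / ω12 * ω23 := by
    calc (M : ℂ) / ω12 * (ω13 : ℂ) = 1 / (a_u : ℂ) * tu + 1 / (a_d : ℂ) * td := by
          rw [e1, e2]; field_simp; ring
      _ = (M : ℂ) / ω12 * ω23 := by rw [← h]; ring
  have := mul_left_cancel₀ (div_ne_zero hM' hw) key
  exact_mod_cast this
end

section
/- For the standard model r-values r_1 = 9/(3+10M), r_2 = r_3 = 3/(6+4M), there is no integer M ≥ 1 such that both ω_12 := 1 − r_1 − 2r_2 = 1/2 and ω_23 := 1 − 2r_2 − 3r_3 = 1/2 hold; likewise, for the extended r-values r_1 = 9/(6+10M), r_2 = 3/(8+4M), r_3 = 3/(6+4M), there is no integer M ≥ 1 such that both ω_12 = 1/2 and ω_23 = 1/2 hold. -/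
/-- Neither for the standard values `r₁ = 9/(3+10M)`, `r₂ = r₃ = 3/(6+4M)` nor for the
extended values `r₁ = 9/(6+10M)`, `r₂ = 3/(8+4M)`, `r₃ = 3/(6+4M)` is there an integer
`M ≥ 1` such that both `ω₁₂ = 1 − r₁ − 2r₂ = 1/2` and `ω₂₃ = 1 − 2r₂ − 3r₃ = 1/2`. -/
theorem stmt_12 :
    (¬ ∃ (M : ℤ), 1 ≤ M ∧
      1 - 9 / (3 + 10 * (M : ℝ)) - 2 * (3 / (6 + 4 * (M : ℝ))) = 1 / 2 ∧
      1 - 2 * (3 / (6 + 4 * (M : ℝ))) - 3 * (3 / (6 + 4 * (M : ℝ))) = 1 / 2) ∧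
    (¬ ∃ (M : ℤ), 1 ≤ M ∧
      1 - 9 / (6 + 10 * (M : ℝ)) - 2 * (3 / (8 + 4 * (M : ℝ))) = 1 / 2 ∧
      1 - 2 * (3 / (8 + 4 * (M : ℝ))) - 3 * (3 / (6 + 4 * (M : ℝ))) = 1 / 2) := by
  constructor
  · rintro ⟨M, hM, h1, h2⟩
    have hR : (1 : ℝ) ≤ M := by exact_mod_cast hM
    have hb : (6 + 4 * (M : ℝ)) ≠ 0 := by
      intro h
      linarith
    have h6 : (M : ℝ) = 6 := by
      field_simp at h2
      linarith
    rw [h6] at h1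
    norm_num at h1
  · rintro ⟨M, hM, h1, h2⟩
    have hR : (1 : ℝ) ≤ M := by exact_mod_cast hM
    have hb : (6 + 4 * (M : ℝ)) ≠ 0 := by
      intro h
      linarith
    have hc : (8 + 4 * (M : ℝ)) ≠ 0 := by
      intro h
      linarith
    have h3 : 2 * (M : ℝ) ^ 2 - 8 * M = 21 := by
      have e : (8 + 4 * (M : ℝ)) * (6 + 4 * M)
          * (1 - 2 * (3 / (8 + 4 * (M : ℝ))) - 3 * (3 / (6 + 4 * (M : ℝ))))
          = (8 + 4 * (M : ℝ)) * (6 + 4 * M) - 6 * (6 + 4 * M) - 9 * (8 + 4 * M) := by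
        field_simp
        ring
      rw [h2] at e
      linarith
    have h4 : 2 * M ^ 2 - 8 * M = 21 := by exact_mod_cast h3
    omega
end
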